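/- Let K/k be a finite abelian extension of number fields with Galois group G, let V be a nonempty finite set of finite places of k, and for each v ∈ V let D_v ≤ G be the decomposition group of v (the stabilizer of any place of K above v). Let S_K be the set of places of K above V, let U_S be the S_K-unit group of K, let S_{∞,K} be the set of infinite places of K, and let ℝS_{∞,K} be the free ℝ-vector space on S_{∞,K} with its natural G-action. Set e = ∏_{v∈V} (1 − e_{D_v}) ∈ ℚ[G] ⊆ ℝ[G], and let L : ℝ ⊗_ℤ U_S → ℝS_{∞,K} be the ℝ[G]-linear map determined by L(u) = −Σ_{w ∈ S_{∞,K}} log|u|_w · w for u ∈ U_S. Then L restricts to an ℝ-linear isomorphism from e·(ℝ ⊗_ℤ U_S) onto e·ℝS_{∞,K}. -/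

import Mathlib

open NumberField IsDedekindDomain TensorProduct

/-- The natural action of a field automorphism `σ` of a number field `K` on the finite places of
`K`: the place `σ(v)`, whose prime ideal is `σ(v.asIdeal) = (σ⁻¹)⁻¹(v.asIdeal)`. -/
noncomputable def galSmul {k K : Type*} [Field k] [Field K] [NumberField K]
    [Algebra k K] (σ : K ≃ₐ[k] K) (v : HeightOneSpectrum (𝓞 K)) :
    HeightOneSpectrum (𝓞 K) where
  asIdeal := v.asIdeal.comap
    ((RingOfIntegers.mapRingEquiv (σ : K ≃+* K)).symm : 𝓞 K →+* 𝓞 K)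
  isPrime := by
    haveI := v.isPrime
    exact Ideal.IsPrime.comap _
  ne_bot := by
    intro h
    apply v.ne_bot
    have := Ideal.map_comap_of_surjective
      ((RingOfIntegers.mapRingEquiv (σ : K ≃+* K)).symm : 𝓞 K →+* 𝓞 K)
      (RingOfIntegers.mapRingEquiv (σ : K ≃+* K)).symm.surjective v.asIdeal
    rw [h, Ideal.map_bot] at this
    exact this.symm

/-- The `ℝ`-linear endomorphism of `ℝ ⊗ℤ Kˣ` induced by a field automorphism `σ` of `K`. -/
noncomputable def galTensorEndR {k K : Type*} [Field k] [Field K] [Algebra k K]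
    (σ : K ≃ₐ[k] K) : Module.End ℝ (ℝ ⊗[ℤ] Additive Kˣ) :=
  LinearMap.baseChange ℝ
    ((MonoidHom.toAdditive
      (Units.map σ.toRingEquiv.toRingHom.toMonoidHom)).toIntLinearMap)

/-- The additive logarithmic embedding `Kˣ → (InfinitePlace K → ℝ)`,
`u ↦ (w ↦ −log |u|_w)`. -/
noncomputable def logEmbeddingHom (K : Type*) [Field K] [NumberField K] :
    Additive Kˣ →+ (NumberField.InfinitePlace K → ℝ) where
  toFun u := fun w => -Real.log (w ((Additive.toMul u : Kˣ) : K))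
  map_zero' := by
    funext w
    simp
  map_add' u u' := by
    funext w
    have h1 : ((Additive.toMul u : Kˣ) : K) ≠ 0 := Units.ne_zero _
    have h2 : ((Additive.toMul u' : Kˣ) : K) ≠ 0 := Units.ne_zero _
    show -Real.log (w (((Additive.toMul u * Additive.toMul u' : Kˣ) : K))) = _
    rw [Units.val_mul, map_mul,
      Real.log_mul (by simp [h1]) (by simp [h2])]
    simp only [Pi.add_apply]
    ring

/-- The `ℝ`-linear logarithmic map `ℝ ⊗ℤ Kˣ → ℝS_{∞,K}` determined by
`u ↦ −Σ_w log|u|_w · w`, where `ℝS_{∞,K}` is the free `ℝ`-vector space on the infinite places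
of `K`, realized as `InfinitePlace K → ℝ`. -/
noncomputable def logMapTensor (K : Type*) [Field K] [NumberField K] :
    (ℝ ⊗[ℤ] Additive Kˣ) →ₗ[ℝ] (NumberField.InfinitePlace K → ℝ) :=
  TensorProduct.AlgebraTensorModule.lift
    { toFun := fun c => c • (logEmbeddingHom K).toIntLinearMap
      map_add' := fun a b => add_smul a b _
      map_smul' := fun a b => by simp [mul_smul] }

/-- The product of the `1 - e_{D i}` comes from the group algebra. -/
theorem ofFn_prod_eq_lift {G A : Type*} [Group G] [Ring A] [Algebra ℝ A] (ρ : G →* A) (n : ℕ)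
    (D : Fin n → Subgroup G) [∀ i, Fintype (D i)] :
    (List.ofFn fun i => (1 : A) - (Fintype.card (D i) : ℝ)⁻¹ • ∑ σ : D i, ρ σ).prod =
      MonoidAlgebra.lift ℝ A G ρ (List.ofFn fun i => (1 : MonoidAlgebra ℝ G) -
        (Fintype.card (D i) : ℝ)⁻¹ • ∑ σ : D i, MonoidAlgebra.of ℝ G σ).prod := by
  rw [map_list_prod, List.map_ofFn]
  congr 2
  ext i
  simp only [Function.comp_apply, map_sub, map_one, map_smul, map_sum]
  simp

theorem isIdempotentElem_avg {G A : Type*} [Group G] [Ring A] [Algebra ℝ A] (ρ : G →* A)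
    (D : Subgroup G) [Fintype D] :
    IsIdempotentElem ((Fintype.card D : ℝ)⁻¹ • ∑ σ : D, ρ σ) := by
  have h (τ : D) : ρ τ * ∑ σ : D, ρ σ = ∑ σ : D, ρ σ := by
    rw [Finset.mul_sum]
    exact Fintype.sum_equiv (Equiv.mulLeft τ) _ _ fun σ => by simp
  have hc : (Fintype.card D : ℝ) ≠ 0 := by simp
  rw [IsIdempotentElem, smul_mul_smul_comm, Finset.sum_mul, Finset.sum_congr rfl fun τ _ => h τ,
    Finset.sum_const, Finset.card_univ, ← Nat.cast_smul_eq_nsmul ℝ, smul_smul]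
  congr 1
  field_simp

theorem isIdempotentElem_ofFn_prod {G A : Type*} [Group G] [Ring A] [Algebra ℝ A]
    (hab : ∀ σ τ : G, σ * τ = τ * σ) (ρ : G →* A) (n : ℕ)
    (D : Fin n → Subgroup G) [∀ i, Fintype (D i)] :
    IsIdempotentElem
      (List.ofFn fun i => (1 : A) - (Fintype.card (D i) : ℝ)⁻¹ • ∑ σ : D i, ρ σ).prod := by
  let _ : CommGroup G := { (inferInstance : Group G) with mul_comm := hab }
  rw [ofFn_prod_eq_lift]
  refine IsIdempotentElem.map ?_ _
  rw [List.prod_ofFn, IsIdempotentElem, ← Finset.prod_mul_distrib]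
  exact Finset.prod_congr rfl fun i _ =>
    (isIdempotentElem_avg (MonoidAlgebra.of ℝ G) (D i)).one_sub

theorem exists_ofFn_prod_eq_mul {G A : Type*} [Group G] [Ring A] [Algebra ℝ A]
    (hab : ∀ σ τ : G, σ * τ = τ * σ) (ρ : G →* A) (n : ℕ)
    (D : Fin n → Subgroup G) [∀ i, Fintype (D i)] (i : Fin n) :
    ∃ b : A, (List.ofFn fun i => (1 : A) - (Fintype.card (D i) : ℝ)⁻¹ • ∑ σ : D i, ρ σ).prod =
      (1 - (Fintype.card (D i) : ℝ)⁻¹ • ∑ σ : D i, ρ σ) * b := by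
  let _ : CommGroup G := { (inferInstance : Group G) with mul_comm := hab }
  rw [ofFn_prod_eq_lift, List.prod_ofFn, ← Finset.mul_prod_erase _ _ (Finset.mem_univ i), map_mul]
  refine ⟨_, congrArg (· * _) ?_⟩
  simp only [map_sub, map_one, map_smul, map_sum]
  simp

theorem comp_ofFn_prod {V W : Type*} [AddCommGroup V] [Module ℝ V] [AddCommGroup W] [Module ℝ W]
    (L : V →ₗ[ℝ] W) (n : ℕ) (f : Fin n → Module.End ℝ V) (g : Fin n → Module.End ℝ W)
    (h : ∀ i x, L (f i x) = g i (L x)) (x : V) :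
    L ((List.ofFn f).prod x) = (List.ofFn g).prod (L x) := by
  induction n with
  | zero => simp
  | succ n ih =>
    simp only [List.ofFn_succ, List.prod_cons, Module.End.mul_apply, h]
    rw [ih _ _ fun i => h i.succ]

theorem ofFn_prod_mem {V : Type*} [AddCommGroup V] [Module ℝ V]
    (M : Submodule ℝ V) (n : ℕ) (f : Fin n → Module.End ℝ V)
    (h : ∀ i, ∀ x ∈ M, f i x ∈ M) {x : V} (hx : x ∈ M) :
    (List.ofFn f).prod x ∈ M := by
  induction n with
  | zero => simpa
  | succ n ih =>
    simp only [List.ofFn_succ, List.prod_cons, Module.End.mul_apply]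
    exact h _ _ (ih _ fun i => h i.succ)

/-- The additive valuation `u ↦ (w ↦ ord_w u)` of a number field, at all finite places. -/
noncomputable def ordHom (K : Type*) [Field K] [NumberField K] :
    Additive Kˣ →+ (HeightOneSpectrum (𝓞 K) →₀ ℤ) where
  toFun u := Finsupp.ofSupportFinite
    (fun w => Multiplicative.toAdd (w.valuationOfNeZero (Additive.toMul u))) (by
      refine ((HeightOneSpectrum.Support.finite (𝓞 K) ((Additive.toMul u : Kˣ) : K)).union
        (HeightOneSpectrum.Support.finite (𝓞 K) ((Additive.toMul u : Kˣ) : K)⁻¹)).subset ?_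
      intro w hw
      have h1 : w.valuation K ((Additive.toMul u : Kˣ) : K) ≠ 1 := by
        rw [← HeightOneSpectrum.valuationOfNeZero_eq]
        exact fun h => hw (by simpa using WithZero.coe_inj.mp (h.trans WithZero.coe_one.symm))
      have h0 : w.valuation K ((Additive.toMul u : Kˣ) : K) ≠ 0 := by simp
      rcases lt_or_gt_of_ne h1 with h | h
      · right
        show 1 < w.valuation K _
        rw [map_inv₀]
        exact (one_lt_inv₀ (zero_lt_iff.mpr h0)).mpr h
      · exact Or.inl h)
  map_zero' := by ext; simp [Finsupp.ofSupportFinite]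
  map_add' u u' := by
    ext w
    exact congrArg Multiplicative.toAdd (map_mul w.valuationOfNeZero _ _)

theorem ordHom_eq_zero_iff {K : Type*} [Field K] [NumberField K] (u : Kˣ)
    (w : HeightOneSpectrum (𝓞 K)) :
    ordHom K (Additive.ofMul u) w = 0 ↔ w.valuation K u = 1 := by
  rw [← HeightOneSpectrum.valuationOfNeZero_eq, ← WithZero.coe_one, WithZero.coe_inj]
  rfl

theorem ordHom_congr {K : Type*} [Field K] [NumberField K] {u u' : Kˣ}
    {w : HeightOneSpectrum (𝓞 K)} (h : w.valuation K (u : K) = w.valuation K (u' : K)) :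
    ordHom K (Additive.ofMul u) w = ordHom K (Additive.ofMul u') w := by
  rw [← HeightOneSpectrum.valuationOfNeZero_eq, ← HeightOneSpectrum.valuationOfNeZero_eq,
    WithZero.coe_inj] at h
  exact congrArg Multiplicative.toAdd h

open scoped Classical in
/-- The `ℝ`-linear extension of the valuation `ord_w` to `ℝ ⊗ Kˣ`. -/
noncomputable def ordTensor {K : Type*} [Field K] [NumberField K]
    (w : HeightOneSpectrum (𝓞 K)) : (ℝ ⊗[ℤ] Additive Kˣ) →ₗ[ℝ] ℝ :=
  Finsupp.lapply w ∘ₗ (TensorProduct.finsuppScalarRight ℤ ℝ ℝ _).toLinearMap ∘ₗ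
    LinearMap.baseChange ℝ (ordHom K).toIntLinearMap

theorem ordTensor_tmul {K : Type*} [Field K] [NumberField K]
    (w : HeightOneSpectrum (𝓞 K)) (r : ℝ) (u : Additive Kˣ) :
    ordTensor w (r ⊗ₜ u) = ordHom K u w * r := by
  simp [ordTensor, TensorProduct.finsuppScalarRight_apply_tmul_apply]

/-- The inclusion `(𝓞 K)ˣ → Kˣ`, additively. -/
noncomputable def unitsHom (K : Type*) [Field K] [NumberField K] :
    Additive (𝓞 K)ˣ →+ Additive Kˣ :=
  MonoidHom.toAdditive (Units.map (algebraMap (𝓞 K) K : 𝓞 K →* K))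

theorem exact_unitsHom_ordHom (K : Type*) [Field K] [NumberField K] :
    Function.Exact (unitsHom K).toIntLinearMap (ordHom K).toIntLinearMap := by
  intro u
  constructor
  · intro h
    have hv (w : HeightOneSpectrum (𝓞 K)) :
        w.valuation K ((Additive.toMul u : Kˣ) : K) = 1 :=
      (ordHom_eq_zero_iff (Additive.toMul u) w).mp (DFunLike.congr_fun h w)
    obtain ⟨a, ha⟩ := HeightOneSpectrum.mem_integers_of_valuation_le_one K
      ((Additive.toMul u : Kˣ) : K) fun w => (hv w).le
    obtain ⟨b, hb⟩ := HeightOneSpectrum.mem_integers_of_valuation_le_one K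
      ((Additive.toMul u : Kˣ) : K)⁻¹ fun w => by rw [map_inv₀, hv, inv_one]
    have hab : a * b = 1 := by
      apply FaithfulSMul.algebraMap_injective (𝓞 K) K
      rw [map_mul, ha, hb, map_one, mul_inv_cancel₀ (Units.ne_zero _)]
    exact ⟨Additive.ofMul ⟨a, b, hab, (mul_comm _ _).trans hab⟩,
      congrArg Additive.ofMul (Units.ext ha)⟩
  · rintro ⟨a, rfl⟩
    ext w
    exact congrArg Multiplicative.toAdd (w.valuation_of_unit_eq (K := K) (Additive.toMul a))

theorem mem_range_unitsHom {K : Type*} [Field K] [NumberField K] {x : ℝ ⊗[ℤ] Additive Kˣ}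
    (hx : ∀ w, ordTensor w x = 0) :
    x ∈ LinearMap.range ((unitsHom K).toIntLinearMap.baseChange ℝ) := by
  classical
  have := Module.Flat.lTensor_exact ℝ (exact_unitsHom_ordHom K)
  obtain ⟨y, hy⟩ := (this x).mp (by
    apply (TensorProduct.finsuppScalarRight ℤ ℝ ℝ (HeightOneSpectrum (𝓞 K))).injective
    rw [map_zero]
    ext w
    exact hx w)
  exact ⟨y, hy⟩

/-- The image of a fundamental system of units in `ℝ ⊗ Kˣ`. -/
noncomputable def fundUnit (K : Type*) [Field K] [NumberField K] (i : Fin (Units.rank K)) :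
    ℝ ⊗[ℤ] Additive Kˣ :=
  1 ⊗ₜ unitsHom K (Additive.ofMul (Units.fundSystem K i))

theorem mem_span_fundUnit {K : Type*} [Field K] [NumberField K] {x : ℝ ⊗[ℤ] Additive Kˣ}
    (hx : ∀ w, ordTensor w x = 0) :
    x ∈ Submodule.span ℝ (Set.range (fundUnit K)) := by
  obtain ⟨y, rfl⟩ := mem_range_unitsHom hx
  clear hx
  induction y using TensorProduct.induction_on with
  | zero => simp
  | add a b ha hb => rw [map_add]; exact add_mem ha hb
  | tmul r u =>
    obtain ⟨⟨ζ, f⟩, h, -⟩ := Units.exist_unique_eq_mul_prod K (Additive.toMul u)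
    have hu : u = Additive.ofMul (ζ : (𝓞 K)ˣ) +
        ∑ i, f i • Additive.ofMul (Units.fundSystem K i) := by
      rw [← ofMul_toMul u, h]
      simp [ofMul_prod]
    have hζ : (1 : ℝ) ⊗ₜ[ℤ] unitsHom K (Additive.ofMul (ζ : (𝓞 K)ˣ)) = 0 := by
      obtain ⟨m, hm, hm'⟩ := isOfFinOrder_iff_pow_eq_one.mp ((CommGroup.mem_torsion _).mp ζ.2)
      have : (m : ℝ) • ((1 : ℝ) ⊗ₜ[ℤ] unitsHom K (Additive.ofMul (ζ : (𝓞 K)ˣ))) = 0 := by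
        rw [Nat.cast_smul_eq_nsmul, ← TensorProduct.tmul_smul, ← map_nsmul, ← ofMul_pow, hm']
        simp
      exact (smul_eq_zero.mp this).resolve_left (by exact_mod_cast hm.ne')
    have : r ⊗ₜ[ℤ] u = r • ((1 : ℝ) ⊗ₜ[ℤ] u) := by simp [TensorProduct.smul_tmul']
    rw [this, map_smul, LinearMap.baseChange_tmul]
    refine Submodule.smul_mem _ _ ?_
    rw [hu]
    simp only [AddMonoidHom.coe_toIntLinearMap, map_add, TensorProduct.tmul_add, hζ, zero_add,
      map_sum, TensorProduct.tmul_sum, map_zsmul, TensorProduct.tmul_smul]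
    refine sum_mem fun i _ => zsmul_mem
      (Submodule.subset_span (Set.mem_range_self (f := fundUnit K) i)) _

theorem fundUnit_mem_span {K : Type*} [Field K] [NumberField K]
    (S : Set (HeightOneSpectrum (𝓞 K))) (i : Fin (Units.rank K)) :
    fundUnit K i ∈ Submodule.span ℝ
      ((fun x : Kˣ => (1 : ℝ) ⊗ₜ[ℤ] Additive.ofMul x) '' ((S.unit K : Subgroup Kˣ) : Set Kˣ)) := by
  refine Submodule.subset_span ⟨_, fun w _ => ?_, rfl⟩
  rw [← ordHom_eq_zero_iff]
  exact DFunLike.congr_fun ((exact_unitsHom_ordHom K).apply_apply_eq_zero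
    (Additive.ofMul (Units.fundSystem K i))) w

theorem logMapTensor_tmul {K : Type*} [Field K] [NumberField K] (r : ℝ) (u : Additive Kˣ) :
    logMapTensor K (r ⊗ₜ u) = r • logEmbeddingHom K u := rfl

theorem logMapTensor_fundUnit {K : Type*} [Field K] [NumberField K] (i : Fin (Units.rank K))
    (w : InfinitePlace K) :
    logMapTensor K (fundUnit K i) w = -Real.log (w (Units.fundSystem K i : K)) := by
  rw [fundUnit, logMapTensor_tmul, one_smul]
  rfl

/-- The linear map forgetting the coordinate at the distinguished infinite place, with weights
such that it maps the logarithms `-log |u|_w` to Mathlib's logarithmic embedding. -/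
noncomputable def toLogSpace (K : Type*) [Field K] [NumberField K] :
    (InfinitePlace K → ℝ) →ₗ[ℝ] Units.dirichletUnitTheorem.logSpace K :=
  LinearMap.pi fun w => (-(w.1.mult : ℝ)) • LinearMap.proj w.1

open scoped Classical in
theorem toLogSpace_logMapTensor_fundUnit {K : Type*} [Field K] [NumberField K]
    (i : Fin (Units.rank K)) :
    toLogSpace K (logMapTensor K (fundUnit K i)) =
      (Units.basisUnitLattice K).ofZLatticeBasis ℝ (Units.unitLattice K) i := by
  rw [Module.Basis.ofZLatticeBasis_apply, ← Units.logEmbedding_fundSystem]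
  ext w
  simp [toLogSpace, logMapTensor_fundUnit]

theorem logMapTensor_injOn_span_fundUnit {K : Type*} [Field K] [NumberField K]
    {x : ℝ ⊗[ℤ] Additive Kˣ} (hx : x ∈ Submodule.span ℝ (Set.range (fundUnit K)))
    (h : logMapTensor K x = 0) : x = 0 := by
  classical
  obtain ⟨c, rfl⟩ := (Submodule.mem_span_range_iff_exists_fun ℝ).mp hx
  have h' := congrArg (toLogSpace K) h
  simp only [map_sum, map_smul, toLogSpace_logMapTensor_fundUnit, map_zero] at h'
  have := Fintype.linearIndependent_iff.mp
    ((Units.basisUnitLattice K).ofZLatticeBasis ℝ (Units.unitLattice K)).linearIndependent c h'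
  simp [this]

theorem sum_mult_mul_logMapTensor_fundUnit {K : Type*} [Field K] [NumberField K]
    (i : Fin (Units.rank K)) :
    ∑ w : InfinitePlace K, (w.mult : ℝ) * logMapTensor K (fundUnit K i) w = 0 := by
  simp [logMapTensor_fundUnit, Units.sum_mult_mul_log]

theorem exists_logMapTensor_eq {K : Type*} [Field K] [NumberField K]
    {f : InfinitePlace K → ℝ} (hf : ∑ w, (w.mult : ℝ) * f w = 0) :
    ∃ x ∈ Submodule.span ℝ (Set.range (fundUnit K)), logMapTensor K x = f := by
  classical
  let b := (Units.basisUnitLattice K).ofZLatticeBasis ℝ (Units.unitLattice K)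
  let x := ∑ i, b.repr (toLogSpace K f) i • fundUnit K i
  refine ⟨x, sum_mem fun i _ => Submodule.smul_mem _ _ (Submodule.subset_span ⟨i, rfl⟩), ?_⟩
  have hx : toLogSpace K (logMapTensor K x) = toLogSpace K f := by
    simp only [x, map_sum, map_smul, toLogSpace_logMapTensor_fundUnit]
    exact b.sum_repr _
  have hxs : ∑ w : InfinitePlace K, (w.mult : ℝ) * logMapTensor K x w = 0 := by
    simp only [x, map_sum, map_smul, Finset.sum_apply, Pi.smul_apply, smul_eq_mul, Finset.mul_sum]
    rw [Finset.sum_comm]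
    refine Finset.sum_eq_zero fun i _ => ?_
    simp_rw [mul_left_comm _ (b.repr (toLogSpace K f) i), ← Finset.mul_sum]
    rw [sum_mult_mul_logMapTensor_fundUnit, mul_zero]
  have hne (w : InfinitePlace K) (hw : w ≠ Units.dirichletUnitTheorem.w₀) :
      logMapTensor K x w = f w := by
    simpa [toLogSpace, InfinitePlace.mult_ne_zero] using congrFun hx ⟨w, hw⟩
  ext w
  by_cases hw : w = Units.dirichletUnitTheorem.w₀
  · rw [Fintype.sum_eq_add_sum_subtype_ne _ w] at hf hxs
    subst hw
    rw [Finset.sum_congr rfl fun w _ => by rw [hne w.1 w.2]] at hxs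
    exact mul_left_cancel₀ (Nat.cast_ne_zero.mpr InfinitePlace.mult_ne_zero)
      (add_right_cancel (hxs.trans hf.symm))
  · exact hne w hw

theorem valuation_galSmul {k K : Type*} [Field k] [Field K] [NumberField K] [Algebra k K]
    (σ : K ≃ₐ[k] K) (w : HeightOneSpectrum (𝓞 K)) (x : K) :
    (galSmul σ w).valuation K (σ x) = w.valuation K x := by
  set s := RingOfIntegers.mapRingEquiv (σ : K ≃+* K)
  have hw : w.asIdeal.map (s : 𝓞 K →+* 𝓞 K) = (galSmul σ w).asIdeal :=
    Ideal.map_comap_of_equiv s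
  have hmem (r : 𝓞 K) (n : ℕ) : s r ∈ (galSmul σ w).asIdeal ^ n ↔ r ∈ w.asIdeal ^ n := by
    rw [← hw, ← Ideal.map_pow]
    exact Ideal.apply_mem_of_equiv_iff
  have hs (r : 𝓞 K) : (galSmul σ w).intValuation (s r) = w.intValuation r := by
    rcases eq_or_ne r 0 with rfl | hr
    · simp
    have hr' : s r ≠ 0 := by simpa
    apply le_antisymm
    · rw [w.intValuation_if_neg hr, HeightOneSpectrum.intValuation_le_pow_iff_mem, hmem,
        ← HeightOneSpectrum.intValuation_le_pow_iff_mem, ← w.intValuation_if_neg hr]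
    · rw [(galSmul σ w).intValuation_if_neg hr', HeightOneSpectrum.intValuation_le_pow_iff_mem,
        ← hmem, ← HeightOneSpectrum.intValuation_le_pow_iff_mem,
        ← (galSmul σ w).intValuation_if_neg hr']
  obtain ⟨a, b, -, rfl⟩ := IsFractionRing.div_surjective (A := 𝓞 K) x
  have hσ (r : 𝓞 K) : σ (algebraMap (𝓞 K) K r) = algebraMap (𝓞 K) K (s r) := rfl
  simp only [map_div₀, hσ, HeightOneSpectrum.valuation_of_algebraMap, hs]

theorem galSmul_galSmul_inv {k K : Type*} [Field k] [Field K] [NumberField K] [Algebra k K]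
    (σ : K ≃ₐ[k] K) (w : HeightOneSpectrum (𝓞 K)) : galSmul σ (galSmul σ⁻¹ w) = w := by
  ext r
  have : (RingOfIntegers.mapRingEquiv ((σ⁻¹ : K ≃ₐ[k] K) : K ≃+* K)).symm
      ((RingOfIntegers.mapRingEquiv (σ : K ≃+* K)).symm r) = r :=
    RingOfIntegers.ext (σ.apply_symm_apply (r : K))
  change (RingOfIntegers.mapRingEquiv ((σ⁻¹ : K ≃ₐ[k] K) : K ≃+* K)).symm
      ((RingOfIntegers.mapRingEquiv (σ : K ≃+* K)).symm r) ∈ w.asIdeal ↔ _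
  rw [this]

theorem comap_galSmul {k K : Type*} [Field k] [Field K] [NumberField K] [Algebra k K]
    (σ : K ≃ₐ[k] K) (w : HeightOneSpectrum (𝓞 K)) :
    (galSmul σ w).asIdeal.comap (algebraMap (𝓞 k) (𝓞 K)) =
      w.asIdeal.comap (algebraMap (𝓞 k) (𝓞 K)) := by
  ext r
  have : (RingOfIntegers.mapRingEquiv (σ : K ≃+* K)).symm (algebraMap (𝓞 k) (𝓞 K) r) =
      algebraMap (𝓞 k) (𝓞 K) r :=
    RingOfIntegers.ext (σ.symm.commutes (r : k))
  change (RingOfIntegers.mapRingEquiv (σ : K ≃+* K)).symm (algebraMap (𝓞 k) (𝓞 K) r) ∈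
    w.asIdeal ↔ _
  rw [this]
  rfl

/-- The action of the Galois group on `ℝ ⊗ Kˣ`. -/
noncomputable def galTensorHom (k K : Type*) [Field k] [Field K] [Algebra k K] :
    (K ≃ₐ[k] K) →* Module.End ℝ (ℝ ⊗[ℤ] Additive Kˣ) where
  toFun := galTensorEndR
  map_one' := by
    ext u
    rfl
  map_mul' σ τ := by
    ext u
    rfl

/-- The action of the Galois group on the free vector space on the infinite places. -/
noncomputable def galPlaceHom (k K : Type*) [Field k] [Field K] [Algebra k K] :
    (K ≃ₐ[k] K) →* Module.End ℝ (InfinitePlace K → ℝ) where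
  toFun σ := LinearMap.funLeft ℝ ℝ fun w => w.comap σ.toRingEquiv.toRingHom
  map_one' := by
    ext f w
    rfl
  map_mul' σ τ := by
    ext f w
    rfl

theorem galTensorHom_tmul {k K : Type*} [Field k] [Field K] [Algebra k K] (σ : K ≃ₐ[k] K)
    (r : ℝ) (u : Kˣ) :
    galTensorHom k K σ (r ⊗ₜ Additive.ofMul u) =
      r ⊗ₜ Additive.ofMul (Units.map σ.toRingEquiv.toRingHom.toMonoidHom u) := rfl

theorem logMapTensor_galTensorHom {k K : Type*} [Field k] [Field K] [NumberField K] [Algebra k K]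
    (σ : K ≃ₐ[k] K) (x : ℝ ⊗[ℤ] Additive Kˣ) :
    logMapTensor K (galTensorHom k K σ x) = galPlaceHom k K σ (logMapTensor K x) := by
  induction x using TensorProduct.induction_on with
  | zero => simp
  | add a b ha hb => simp only [map_add, ha, hb]
  | tmul r u => rfl

theorem ordTensor_galTensorHom {k K : Type*} [Field k] [Field K] [NumberField K] [Algebra k K]
    {σ : K ≃ₐ[k] K} {w : HeightOneSpectrum (𝓞 K)} (h : galSmul σ w = w)
    (x : ℝ ⊗[ℤ] Additive Kˣ) :
    ordTensor w (galTensorHom k K σ x) = ordTensor w x := by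
  induction x using TensorProduct.induction_on with
  | zero => simp
  | add a b ha hb => simp only [map_add, ha, hb]
  | tmul r u =>
    have hv := valuation_galSmul σ w ((Additive.toMul u : Kˣ) : K)
    rw [h] at hv
    rw [← ofMul_toMul u, galTensorHom_tmul, ordTensor_tmul, ordTensor_tmul, ordHom_congr hv]

theorem galTensorHom_mem_span {k K : Type*} [Field k] [Field K] [NumberField K] [Algebra k K]
    {S : Set (HeightOneSpectrum (𝓞 K))}
    (hS : ∀ (σ : K ≃ₐ[k] K) (w : HeightOneSpectrum (𝓞 K)), galSmul σ w ∈ S → w ∈ S)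
    (σ : K ≃ₐ[k] K) {x : ℝ ⊗[ℤ] Additive Kˣ}
    (hx : x ∈ Submodule.span ℝ ((fun x : Kˣ => (1 : ℝ) ⊗ₜ[ℤ] Additive.ofMul x) ''
      ((S.unit K : Subgroup Kˣ) : Set Kˣ))) :
    galTensorHom k K σ x ∈ Submodule.span ℝ
      ((fun x : Kˣ => (1 : ℝ) ⊗ₜ[ℤ] Additive.ofMul x) ''
        ((S.unit K : Subgroup Kˣ) : Set Kˣ)) := by
  induction hx using Submodule.span_induction with
  | zero => simp
  | add x y _ _ hx hy => rw [map_add]; exact add_mem hx hy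
  | smul r x _ hx => rw [map_smul]; exact Submodule.smul_mem _ _ hx
  | mem x hx =>
    obtain ⟨u, hu, rfl⟩ := hx
    refine Submodule.subset_span ⟨_, fun w hw => ?_, rfl⟩
    have h := valuation_galSmul σ (galSmul σ⁻¹ w) (u : K)
    rw [galSmul_galSmul_inv] at h
    exact h.trans (hu (galSmul σ⁻¹ w) fun h => hw (hS _ _ h))

theorem ordTensor_eq_zero_of_mem_span {K : Type*} [Field K] [NumberField K]
    {S : Set (HeightOneSpectrum (𝓞 K))} {w : HeightOneSpectrum (𝓞 K)} (hw : w ∉ S)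
    {x : ℝ ⊗[ℤ] Additive Kˣ}
    (hx : x ∈ Submodule.span ℝ ((fun x : Kˣ => (1 : ℝ) ⊗ₜ[ℤ] Additive.ofMul x) ''
      ((S.unit K : Subgroup Kˣ) : Set Kˣ))) :
    ordTensor w x = 0 := by
  induction hx using Submodule.span_induction with
  | zero => simp
  | add x y _ _ hx hy => rw [map_add, hx, hy, add_zero]
  | smul r x _ hx => rw [map_smul, hx, smul_zero]
  | mem x hx =>
    obtain ⟨u, hu, rfl⟩ := hx
    rw [ordTensor_tmul, (ordHom_eq_zero_iff u w).mpr (hu w hw), Int.cast_zero, zero_mul]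

theorem sum_mult_mul_galPlaceHom {k K : Type*} [Field k] [Field K] [NumberField K] [Algebra k K]
    (σ : K ≃ₐ[k] K) (f : InfinitePlace K → ℝ) :
    ∑ w, (w.mult : ℝ) * galPlaceHom k K σ f w = ∑ w, (w.mult : ℝ) * f w := by
  refine Fintype.sum_equiv (MulAction.toPerm σ⁻¹) _ _ fun w => ?_
  have : (σ⁻¹ • w).mult = w.mult := by
    classical
    unfold InfinitePlace.mult
    congr 1
    exact propext InfinitePlace.isReal_smul_iff
  rw [MulAction.toPerm_apply, this]
  rfl

theorem map_one_sub_avg_eq_zero {G V : Type*} [Group G] [AddCommGroup V] [Module ℝ V]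
    (ρ : G →* Module.End ℝ V) (D : Subgroup G) [Fintype D] (φ : V →ₗ[ℝ] ℝ)
    (h : ∀ σ ∈ D, ∀ x, φ (ρ σ x) = φ x) (x : V) :
    φ ((1 - (Fintype.card D : ℝ)⁻¹ • ∑ σ : D, ρ σ) x) = 0 := by
  simp only [LinearMap.sub_apply, Module.End.one_apply, LinearMap.smul_apply, LinearMap.sum_apply,
    map_sub, map_smul, map_sum]
  rw [Finset.sum_congr rfl fun σ _ => h σ.1 σ.2 x]
  simp

theorem map_one_sub_avg {G V W : Type*} [Group G] [AddCommGroup V] [Module ℝ V]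
    [AddCommGroup W] [Module ℝ W] (ρ : G →* Module.End ℝ V) (ρ' : G →* Module.End ℝ W)
    (D : Subgroup G) [Fintype D] (L : V →ₗ[ℝ] W) (h : ∀ σ x, L (ρ σ x) = ρ' σ (L x)) (x : V) :
    L ((1 - (Fintype.card D : ℝ)⁻¹ • ∑ σ : D, ρ σ) x) =
      (1 - (Fintype.card D : ℝ)⁻¹ • ∑ σ : D, ρ' σ) (L x) := by
  simp [h]

theorem one_sub_avg_mem {G V : Type*} [Group G] [AddCommGroup V] [Module ℝ V]
    (ρ : G →* Module.End ℝ V) (D : Subgroup G) [Fintype D] (M : Submodule ℝ V)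
    (h : ∀ σ, ∀ x ∈ M, ρ σ x ∈ M) {x : V} (hx : x ∈ M) :
    (1 - (Fintype.card D : ℝ)⁻¹ • ∑ σ : D, ρ σ) x ∈ M := by
  simp only [LinearMap.sub_apply, Module.End.one_apply, LinearMap.smul_apply, LinearMap.sum_apply]
  exact sub_mem hx (M.smul_mem _ (sum_mem fun σ _ => h σ x hx))

set_option synthInstance.maxHeartbeats 1000000 in
set_option maxHeartbeats 1000000 in
open scoped Classical in
/-- Let `K/k` be a finite abelian extension of number fields with Galois group
`G`, `V = {v 1, …, v n}` a nonempty finite set of finite places of `k` with decomposition groups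
`D i ≤ G`, `S_K` the places of `K` above `V`, and `U_S` the `S_K`-units.  Set
`e = ∏ (1 − e_{D i})`, acting on `ℝ ⊗ℤ Kˣ` (restricting the action on `ℝ ⊗ U_S`) and on the
free vector space `ℝS_{∞,K}` on the infinite places of `K` (via `w ↦ w ∘ σ`).  Let
`L : ℝ ⊗ U_S → ℝS_{∞,K}`, `L(u) = −Σ_w log|u|_w · w`.  Then `L` restricts to an `ℝ`-linear
isomorphism from `e·(ℝ ⊗ U_S)` onto `e·ℝS_{∞,K}`: it maps the former onto the latter and is
injective on it. -/
theorem stmt9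
    (k K : Type*) [Field k] [Field K] [NumberField k] [NumberField K]
    [Algebra k K] [IsGalois k K] [FiniteDimensional k K]
    (hab : ∀ σ τ : K ≃ₐ[k] K, σ * τ = τ * σ)
    (n : ℕ) (hn : 0 < n) (v : Fin n → HeightOneSpectrum (𝓞 k))
    (D : Fin n → Subgroup (K ≃ₐ[k] K))
    (hD : ∀ i : Fin n, ∀ w : HeightOneSpectrum (𝓞 K),
      w.asIdeal.comap (algebraMap (𝓞 k) (𝓞 K)) = (v i).asIdeal →
      ∀ σ : K ≃ₐ[k] K, σ ∈ D i ↔ galSmul σ w = w) :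
    let e : Module.End ℝ (ℝ ⊗[ℤ] Additive Kˣ) :=
      (List.ofFn (fun i : Fin n =>
        (1 : Module.End ℝ (ℝ ⊗[ℤ] Additive Kˣ)) -
          (Fintype.card (D i) : ℝ)⁻¹ •
            ∑ σ : (D i), galTensorEndR (k := k) (σ : K ≃ₐ[k] K))).prod
    let e' : Module.End ℝ (NumberField.InfinitePlace K → ℝ) :=
      (List.ofFn (fun i : Fin n =>
        (1 : Module.End ℝ (NumberField.InfinitePlace K → ℝ)) -
          (Fintype.card (D i) : ℝ)⁻¹ •
            ∑ σ : (D i), LinearMap.funLeft ℝ ℝ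
              (fun w : NumberField.InfinitePlace K =>
                w.comap (σ : K ≃ₐ[k] K).toRingEquiv.toRingHom))).prod
    let eUS : Submodule ℝ (ℝ ⊗[ℤ] Additive Kˣ) :=
      Submodule.map e
        (Submodule.span ℝ
          ((fun x : Kˣ => (1 : ℝ) ⊗ₜ[ℤ] Additive.ofMul x) ''
            (({w : HeightOneSpectrum (𝓞 K) |
                ∃ i : Fin n, w.asIdeal.comap (algebraMap (𝓞 k) (𝓞 K)) = (v i).asIdeal}.unit K :
              Subgroup Kˣ) : Set Kˣ)))
    Submodule.map (logMapTensor K) eUS = Submodule.map e' ⊤ ∧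
      ∀ x ∈ eUS, logMapTensor K x = 0 → x = 0 := by
  intro e e' eUS
  set S : Set (HeightOneSpectrum (𝓞 K)) := {w | ∃ i : Fin n,
    w.asIdeal.comap (algebraMap (𝓞 k) (𝓞 K)) = (v i).asIdeal}
  have hSmul (σ : K ≃ₐ[k] K) (w) (h : galSmul σ w ∈ S) : w ∈ S := by
    obtain ⟨i, hi⟩ := h
    exact ⟨i, (comap_galSmul σ w).symm.trans hi⟩
  have he' : e' * e' = e' := isIdempotentElem_ofFn_prod hab (galPlaceHom k K) n D
  have hL (x) : logMapTensor K (e x) = e' (logMapTensor K x) :=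
    comp_ofFn_prod _ n _ _ (fun i => map_one_sub_avg (galTensorHom k K) (galPlaceHom k K) (D i) _
      logMapTensor_galTensorHom) x
  have hord {x} (hx : x ∈ Submodule.span ℝ ((fun x : Kˣ => (1 : ℝ) ⊗ₜ[ℤ] Additive.ofMul x) ''
      ((S.unit K : Subgroup Kˣ) : Set Kˣ))) (w) : ordTensor w (e x) = 0 := by
    by_cases hw : w ∈ S
    · obtain ⟨i, hi⟩ := hw
      obtain ⟨b, hb⟩ := exists_ofFn_prod_eq_mul hab (galTensorHom k K) n D i
      have he : e x = _ := LinearMap.congr_fun hb x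
      rw [he, Module.End.mul_apply]
      exact map_one_sub_avg_eq_zero _ _ _
        (fun σ hσ => ordTensor_galTensorHom ((hD i w hi σ).mp hσ)) _
    · refine ordTensor_eq_zero_of_mem_span hw (ofFn_prod_mem _ n _ (fun i x hx => ?_) hx)
      exact one_sub_avg_mem (galTensorHom k K) (D i) _
        (fun σ x hx => galTensorHom_mem_span hSmul σ hx) hx
  refine ⟨le_antisymm ?_ ?_, ?_⟩
  · rintro _ ⟨_, ⟨x, -, rfl⟩, rfl⟩
    exact ⟨logMapTensor K x, trivial, (hL x).symm⟩
  · rintro _ ⟨f, -, rfl⟩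
    obtain ⟨b, hb⟩ := exists_ofFn_prod_eq_mul hab (galPlaceHom k K) n D ⟨0, hn⟩
    have he : e' f = _ := LinearMap.congr_fun hb f
    obtain ⟨y, hy, hLy⟩ := exists_logMapTensor_eq (f := e' f) (by
      have := map_one_sub_avg_eq_zero (galPlaceHom k K) (D ⟨0, hn⟩)
        (∑ w : InfinitePlace K, (w.mult : ℝ) • LinearMap.proj w)
        (fun σ _ f => by simpa using sum_mult_mul_galPlaceHom σ f) (b f)
      rw [he, Module.End.mul_apply]
      simpa using this)
    refine ⟨e y, ⟨y, ?_, rfl⟩, ?_⟩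
    · exact Submodule.span_le.mpr (Set.range_subset_iff.mpr (fundUnit_mem_span S)) hy
    · rw [hL, hLy, ← Module.End.mul_apply, he']
  · rintro _ ⟨x, hx, rfl⟩ h
    exact logMapTensor_injOn_span_fundUnit (mem_span_fundUnit (hord hx)) h
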